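/- Let (Ω,ℱ,P) be a probability space, L ∈ (0,∞], and let a : [0,L]×Ω → ℝ be such that ω ↦ a(t,ω) is ℱ-measurable for every t ∈ [0,L] and every path t ↦ a(t,ω) is left-continuous and of bounded variation on [0,L]. Then the set S = { (t,ω) ∈ [0,L]×Ω : the functions s ↦ a₊(s,ω) and s ↦ a₋(s,ω) are both differentiable at t (one-sidedly at the endpoints of [0,L]) } belongs to 𝓛([0,L])⊗ℱ. -/

import Mathlib

open MeasureTheory Filter Set
open scoped Topology ENNReal

noncomputable section

/-- The interval `[0, L]` for `L ∈ (0, ∞]`; equals `[0, ∞)` when `L = ∞`. -/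
def II (L : ℝ≥0∞) : Set ℝ := {t : ℝ | 0 ≤ t ∧ ENNReal.ofReal t ≤ L}

/-- The interval `[0, L)`. -/
def IIco (L : ℝ≥0∞) : Set ℝ := {t : ℝ | 0 ≤ t ∧ ENNReal.ofReal t < L}

/-- The interval `(0, L]`. -/
def IIoc (L : ℝ≥0∞) : Set ℝ := {t : ℝ | 0 < t ∧ ENNReal.ofReal t ≤ L}

/-- The set of partition sums `∑_{j=1}^n f(v(t_j) - v(t_{j-1}))` over all finite partitions
`0 = t₀ < t₁ < ⋯ < t_n = t` (with `n ∈ ℕ₀`). -/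
def partitionSums (f : ℝ → ℝ) (v : ℝ → ℝ) (t : ℝ) : Set ℝ :=
  { S : ℝ | ∃ (n : ℕ) (u : ℕ → ℝ), u 0 = 0 ∧ u n = t ∧ (∀ j, j < n → u j < u (j + 1)) ∧
      S = ∑ j ∈ Finset.range n, f (v (u (j + 1)) - v (u j)) }

/-- The positive variation `v₊(t)` (with `sup ∅ = 0`, via `Real.sSup`). -/
def posVar (v : ℝ → ℝ) (t : ℝ) : ℝ := sSup (partitionSums (fun x => max x 0) v t)

/-- The negative variation `v₋(t)` (with `sup ∅ = 0`, via `Real.sSup`). -/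
def negVar (v : ℝ → ℝ) (t : ℝ) : ℝ := sSup (partitionSums (fun x => max (-x) 0) v t)

/-- `v` is of bounded variation on `[0,L]`: `sup_{t ∈ [0,L]} (v₊(t) + v₋(t)) < ∞`. -/
def IsBV (L : ℝ≥0∞) (v : ℝ → ℝ) : Prop :=
  ∃ M : ℝ, ∀ t ∈ II L, ∀ Sp ∈ partitionSums (fun x => max x 0) v t,
    ∀ Sn ∈ partitionSums (fun x => max (-x) 0) v t, Sp + Sn ≤ M

/-- `v` is left-continuous at every point of `[0,L]`. -/
def LeftCts (L : ℝ≥0∞) (v : ℝ → ℝ) : Prop :=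
  ∀ t ∈ II L, 0 < t → Tendsto v (𝓝[<] t) (𝓝 (v t))

/-- The Lebesgue σ-algebra on `ℝ` (the completion of the Borel σ-algebra w.r.t. Lebesgue
measure, i.e. the null-measurable sets of `volume`). -/
def lebSA : MeasurableSpace ℝ :=
  (inferInstance : MeasurableSpace (NullMeasurableSpace ℝ (volume : Measure ℝ)))

/-- Conditions on the integrand. -/
structure GoodF (f : ℝ → ℝ) : Prop where
  cont : Continuous f
  nonneg : ∀ x, 0 ≤ f x
  zero : f 0 = 0
  sub : ∀ x y, f (x + y) ≤ f x + f y

theorem goodF_pos : GoodF (fun x : ℝ => max x 0) where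
  cont := by fun_prop
  nonneg x := le_max_right _ _
  zero := by simp
  sub x y := by
    refine max_le ?_ ?_
    · exact add_le_add (le_max_left _ _) (le_max_left _ _)
    · exact add_nonneg (le_max_right _ _) (le_max_right _ _)

theorem goodF_neg : GoodF (fun x : ℝ => max (-x) 0) where
  cont := by fun_prop
  nonneg x := le_max_right _ _
  zero := by simp
  sub x y := by
    refine max_le ?_ ?_
    · rw [neg_add]
      exact add_le_add (le_max_left _ _) (le_max_left _ _)
    · exact add_nonneg (le_max_right _ _) (le_max_right _ _)

theorem II_mem_of_le {L : ℝ≥0∞} {s t : ℝ} (ht : t ∈ II L) (h0 : 0 ≤ s) (hst : s ≤ t) :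
    s ∈ II L :=
  ⟨h0, (ENNReal.ofReal_le_ofReal hst).trans ht.2⟩

theorem II_measurable (L : ℝ≥0∞) : MeasurableSet (II L) := by
  unfold II
  exact (measurableSet_le measurable_const measurable_id).inter
    (measurableSet_le ENNReal.measurable_ofReal measurable_const)

theorem bdd_pos {L : ℝ≥0∞} {v : ℝ → ℝ} (h : IsBV L v) {t : ℝ} (ht : t ∈ II L) :
    BddAbove (partitionSums (fun x => max x 0) v t) := by
  obtain ⟨M, hM⟩ := h
  refine ⟨M, ?_⟩
  rintro S ⟨n, u, h0, hn, hu, rfl⟩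
  have := hM t ht _ ⟨n, u, h0, hn, hu, rfl⟩ _ ⟨n, u, h0, hn, hu, rfl⟩
  have h2 : 0 ≤ ∑ j ∈ Finset.range n, max (-(v (u (j + 1)) - v (u j))) 0 :=
    Finset.sum_nonneg fun _ _ => le_max_right _ _
  linarith

theorem bdd_neg {L : ℝ≥0∞} {v : ℝ → ℝ} (h : IsBV L v) {t : ℝ} (ht : t ∈ II L) :
    BddAbove (partitionSums (fun x => max (-x) 0) v t) := by
  obtain ⟨M, hM⟩ := h
  refine ⟨M, ?_⟩
  rintro S ⟨n, u, h0, hn, hu, rfl⟩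
  have := hM t ht _ ⟨n, u, h0, hn, hu, rfl⟩ _ ⟨n, u, h0, hn, hu, rfl⟩
  have h2 : 0 ≤ ∑ j ∈ Finset.range n, max (v (u (j + 1)) - v (u j)) 0 :=
    Finset.sum_nonneg fun _ _ => le_max_right _ _
  linarith

theorem partitionSums_nonempty (f v : ℝ → ℝ) {t : ℝ} (ht : 0 ≤ t) :
    (partitionSums f v t).Nonempty := by
  rcases ht.eq_or_lt with rfl | ht
  · exact ⟨_, 0, fun _ => 0, rfl, rfl, by simp, rfl⟩
  · refine ⟨_, 1, fun j => if j = 0 then 0 else t, by simp, by simp, ?_, rfl⟩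
    intro j hj
    have : j = 0 := by omega
    simp [this, ht]

theorem partition_le {n : ℕ} {u : ℕ → ℝ} (hu : ∀ j, j < n → u j < u (j + 1)) :
    ∀ i j, i ≤ j → j ≤ n → u i ≤ u j := by
  intro i j hij
  induction j, hij using Nat.le_induction with
  | base => intro _; exact le_rfl
  | succ k hk ih =>
    intro h
    exact (ih (by omega)).trans (hu k (by omega)).le

/-- Variation function. -/
def VV (f v : ℝ → ℝ) (t : ℝ) : ℝ := sSup (partitionSums f v t)

/-- Replace the last point / append. -/
theorem append_sum {f v : ℝ → ℝ} {n : ℕ} {u : ℕ → ℝ} {s : ℝ} (h0 : u 0 = 0)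
    (hu : ∀ j, j < n → u j < u (j + 1)) (hs : u n < s) :
    (∑ j ∈ Finset.range n, f (v (u (j + 1)) - v (u j))) + f (v s - v (u n))
      ∈ partitionSums f v s := by
  refine ⟨n + 1, fun j => if j ≤ n then u j else s, by simp [h0], by simp, ?_, ?_⟩
  · intro j hj
    rcases Nat.lt_succ_iff_lt_or_eq.mp hj with h | rfl
    · simpa [h.le, Nat.succ_le_of_lt h] using hu j h
    · simpa using hs
  · rw [Finset.sum_range_succ]
    congr 1
    · refine Finset.sum_congr rfl fun j hj => ?_
      have hj := Finset.mem_range.mp hj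
      simp [hj.le, Nat.succ_le_of_lt hj]
    · simp

theorem VV_mono {L : ℝ≥0∞} {f v : ℝ → ℝ} (hf : GoodF f)
    (hb : ∀ t ∈ II L, BddAbove (partitionSums f v t)) {s t : ℝ} (hs : 0 ≤ s) (hst : s ≤ t)
    (ht : t ∈ II L) : VV f v s ≤ VV f v t := by
  rcases hst.eq_or_lt with rfl | hst
  · exact le_rfl
  refine csSup_le (partitionSums_nonempty f v hs) ?_
  rintro S ⟨n, u, h0, hn, hu, rfl⟩
  refine le_trans ?_ (le_csSup (hb t ht) (append_sum h0 hu (hn ▸ hst)))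
  have := hf.nonneg (v t - v (u n))
  linarith

theorem VV_leftcts {L : ℝ≥0∞} {f v : ℝ → ℝ} (hf : GoodF f) (hv : LeftCts L v)
    (hb : ∀ t ∈ II L, BddAbove (partitionSums f v t)) : LeftCts L (VV f v) := by
  intro t ht h0t
  rw [tendsto_order]
  have hpos : ∀ᶠ s in 𝓝[<] t, 0 < s ∧ s < t := Ioo_mem_nhdsLT h0t
  constructor
  · intro c hc
    obtain ⟨S, ⟨n, u, h0, hn, hu, rfl⟩, hS⟩ :=
      exists_lt_of_lt_csSup (partitionSums_nonempty f v h0t.le) hc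
    obtain _ | n := n
    · exact absurd (h0.symm.trans hn) h0t.ne
    rw [Finset.sum_range_succ, hn] at hS
    have hlim : Tendsto (fun s => (∑ j ∈ Finset.range n, f (v (u (j + 1)) - v (u j)))
        + f (v s - v (u n))) (𝓝[<] t) (𝓝 ((∑ j ∈ Finset.range n, f (v (u (j + 1)) - v (u j)))
        + f (v t - v (u n)))) :=
      tendsto_const_nhds.add ((hf.cont.tendsto _).comp ((hv t ht h0t).sub_const _))
    have hun : u n < t := hn ▸ hu n (Nat.lt_succ_self n)
    have h1 : ∀ᶠ s in 𝓝[<] t, u n < s := by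
      filter_upwards [Ioo_mem_nhdsLT hun] with s hs using hs.1
    filter_upwards [hlim.eventually (lt_mem_nhds hS), h1, hpos] with s hs hs1 hs2
    exact hs.trans_le (le_csSup (hb s (II_mem_of_le ht hs2.1.le hs2.2.le))
      (append_sum h0 (fun j hj => hu j (by omega)) hs1))
  · intro c hc
    filter_upwards [hpos] with s hs
    exact (VV_mono hf hb hs.1.le hs.2.le ht).trans_lt hc

/-- uniform partition sums -/
def US (f v : ℝ → ℝ) (t : ℝ) (N : ℕ) : ℝ :=
  ∑ i ∈ Finset.range (N + 1), f (v (t * ((i + 1 : ℕ) / (N + 1 : ℝ))) - v (t * ((i : ℕ) / (N + 1 : ℝ))))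

theorem US_mem {f v : ℝ → ℝ} {t : ℝ} (ht : 0 < t) (N : ℕ) : US f v t N ∈ partitionSums f v t := by
  refine ⟨N + 1, fun i => t * ((i : ℕ) / (N + 1 : ℝ)), by simp, ?_, ?_, rfl⟩
  · have : (N + 1 : ℝ) ≠ 0 := by positivity
    push_cast
    field_simp
  · intro j _
    have : (0 : ℝ) < N + 1 := by positivity
    push_cast
    gcongr
    linarith

theorem f_sum_le {f : ℝ → ℝ} (hf : GoodF f) (w : ℕ → ℝ) {m n : ℕ} (hmn : m ≤ n) :
    f (w n - w m) ≤ ∑ i ∈ Finset.Ico m n, f (w (i + 1) - w i) := by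
  induction n, hmn using Nat.le_induction with
  | base => simp [hf.zero]
  | succ k hk ih =>
    rw [Finset.sum_Ico_succ_top hk]
    have := hf.sub (w k - w m) (w (k + 1) - w k)
    have e : w k - w m + (w (k + 1) - w k) = w (k + 1) - w m := by ring
    rw [e] at this
    linarith

theorem coarse_le {f : ℝ → ℝ} (hf : GoodF f) (w : ℕ → ℝ) (k : ℕ → ℕ) (n : ℕ)
    (hk : ∀ j, j < n → k j ≤ k (j + 1)) :
    ∑ j ∈ Finset.range n, f (w (k (j + 1)) - w (k j)) ≤
      ∑ i ∈ Finset.range (k n), f (w (i + 1) - w i) := by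
  induction n with
  | zero => exact Finset.sum_nonneg fun _ _ => hf.nonneg _
  | succ n ih =>
    rw [Finset.sum_range_succ, ← Finset.sum_range_add_sum_Ico _ (hk n (Nat.lt_succ_self n))]
    exact add_le_add (ih fun j hj => hk j (by omega)) (f_sum_le hf w (hk n (Nat.lt_succ_self n)))

theorem tendsto_left {L : ℝ≥0∞} {v : ℝ → ℝ} (hv : LeftCts L v) {s : ℝ} (hs : s ∈ II L)
    {x : ℕ → ℝ} (hx : Tendsto x atTop (𝓝 s)) (hle : ∀ n, x n ≤ s) (h0 : ∀ n, 0 ≤ x n) :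
    Tendsto (fun n => v (x n)) atTop (𝓝 (v s)) := by
  rcases hs.1.eq_or_lt with rfl | h
  · have : ∀ n, x n = 0 := fun n => le_antisymm (hle n) (h0 n)
    simp [this]
  · have h1 : Tendsto v (𝓝[≤] s) (𝓝 (v s)) := by
      have : ContinuousWithinAt v (Iio s) s := hv s hs h
      exact continuousWithinAt_Iio_iff_Iic.mp this
    exact h1.comp (tendsto_nhdsWithin_iff.mpr ⟨hx, Eventually.of_forall hle⟩)

theorem floor_tendsto (x : ℝ) (hx : 0 ≤ x) :
    Tendsto (fun N : ℕ => (⌊x * (N + 1 : ℝ)⌋₊ : ℝ) / (N + 1 : ℝ)) atTop (𝓝 x) := by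
  have h := (tendsto_nat_floor_mul_div_atTop hx).comp
    ((tendsto_natCast_atTop_atTop (R := ℝ)).comp (tendsto_add_atTop_nat 1))
  simpa [Function.comp_def] using h

theorem VV_eq_iSup {L : ℝ≥0∞} {f v : ℝ → ℝ} (hf : GoodF f) (hv : LeftCts L v)
    (hb : ∀ t ∈ II L, BddAbove (partitionSums f v t)) {t : ℝ} (ht : t ∈ II L) (h0t : 0 < t) :
    VV f v t = ⨆ N : ℕ, US f v t N := by
  have hbd : BddAbove (range (US f v t)) := by
    refine (hb t ht).mono ?_
    rintro _ ⟨N, rfl⟩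
    exact US_mem h0t N
  apply le_antisymm
  · refine csSup_le (partitionSums_nonempty f v h0t.le) ?_
    rintro S ⟨n, u, h0, hn, hu, rfl⟩
    have hmem : ∀ j, j ≤ n → 0 ≤ u j ∧ u j ≤ t := fun j hj =>
      ⟨h0 ▸ partition_le hu 0 j (Nat.zero_le _) hj, hn ▸ partition_le hu j n hj le_rfl⟩
    let k : ℕ → ℕ → ℕ := fun N j => ⌊u j / t * (N + 1 : ℝ)⌋₊
    have hlim : ∀ j, j ≤ n →
        Tendsto (fun N => v (t * ((k N j : ℕ) / (N + 1 : ℝ)))) atTop (𝓝 (v (u j))) := by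
      intro j hj
      have hq : 0 ≤ u j / t := div_nonneg (hmem j hj).1 h0t.le
      have e : t * (u j / t) = u j := by field_simp
      refine tendsto_left hv (II_mem_of_le ht (hmem j hj).1 (hmem j hj).2) ?_ ?_ ?_
      · have := (floor_tendsto (u j / t) hq).const_mul t
        rwa [e] at this
      · intro N
        have hN : (0 : ℝ) < N + 1 := by positivity
        rw [← e]
        refine mul_le_mul_of_nonneg_left ?_ h0t.le
        rw [div_le_iff₀ hN]
        exact Nat.floor_le (by positivity)
      · intro N
        positivity
    have hlimS : Tendsto (fun N => ∑ j ∈ Finset.range n,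
        f (v (t * ((k N (j + 1) : ℕ) / (N + 1 : ℝ))) - v (t * ((k N j : ℕ) / (N + 1 : ℝ)))))
        atTop (𝓝 (∑ j ∈ Finset.range n, f (v (u (j + 1)) - v (u j)))) := by
      refine tendsto_finsetSum _ fun j hj => ?_
      have hj := Finset.mem_range.mp hj
      exact (hf.cont.tendsto _).comp ((hlim (j + 1) hj).sub (hlim j hj.le))
    refine le_of_tendsto hlimS (Eventually.of_forall fun N => ?_)
    refine le_trans ?_ (le_ciSup hbd N)
    have hkn : k N n = N + 1 := by
      simp only [k, hn, div_self h0t.ne', one_mul]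
      exact_mod_cast Nat.floor_natCast (N + 1)
    have := coarse_le hf (fun i => v (t * ((i : ℕ) / (N + 1 : ℝ)))) (k N) n (fun j hj => by
      refine Nat.floor_le_floor ?_
      have := (hu j hj).le
      gcongr)
    rw [hkn] at this
    exact this
  · exact ciSup_le fun N => le_csSup (hb t ht) (US_mem h0t N)

theorem VV_zero (f v : ℝ → ℝ) : VV f v 0 = 0 := by
  have : partitionSums f v 0 = {0} := by
    ext S
    constructor
    · rintro ⟨n, u, h0, hn, hu, rfl⟩
      obtain _ | n := n
      · simp
      · have h1 := partition_le hu 0 n (Nat.zero_le _) (Nat.le_succ n)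
        have h2 := hu n (Nat.lt_succ_self n)
        linarith
    · rintro rfl
      exact ⟨0, fun _ => 0, rfl, rfl, by simp, by simp⟩
  rw [VV, this, csSup_singleton]

theorem VV_meas {Ω : Type*} [MeasurableSpace Ω] {L : ℝ≥0∞} {f : ℝ → ℝ} (hf : GoodF f)
    {a : ℝ → Ω → ℝ} (hmeas : ∀ t ∈ II L, Measurable fun ω => a t ω)
    (hlc : ∀ ω : Ω, LeftCts L fun t => a t ω)
    (hb : ∀ ω, ∀ t ∈ II L, BddAbove (partitionSums f (fun u => a u ω) t))
    {t : ℝ} (ht : t ∈ II L) : Measurable fun ω => VV f (fun u => a u ω) t := by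
  rcases ht.1.eq_or_lt with rfl | h0t
  · simp only [VV_zero]
    exact measurable_const
  simp_rw [fun ω => VV_eq_iSup hf (hlc ω) (hb ω) ht h0t]
  refine Measurable.iSup fun N => ?_
  unfold US
  have key : ∀ i : ℕ, i ≤ N + 1 → t * ((i : ℕ) / (N + 1 : ℝ)) ∈ II L := by
    intro i hi
    have hN : (0 : ℝ) < N + 1 := by positivity
    refine II_mem_of_le ht (by positivity) ?_
    have : ((i : ℕ) / (N + 1 : ℝ)) ≤ 1 := by
      rw [div_le_one hN]
      exact_mod_cast hi
    nlinarith
  refine Finset.measurable_sum _ fun i hi => ?_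
  have hi := Finset.mem_range.mp hi
  exact hf.cont.measurable.comp ((hmeas _ (key (i + 1) hi)).sub (hmeas _ (key i hi.le)))

theorem floor_meas {Ω : Type*} [MeasurableSpace Ω] {G : ℝ → Ω → ℝ}
    (hG : ∀ t, Measurable (G t)) (n : ℕ) :
    Measurable fun p : ℝ × Ω => G ((⌊p.1 * (n + 1 : ℝ)⌋₊ : ℝ) / (n + 1 : ℝ)) p.2 := by
  have h1 : Measurable fun q : ℕ × Ω => G ((q.1 : ℝ) / (n + 1 : ℝ)) q.2 :=
    measurable_from_prod_countable_right fun k => hG ((k : ℝ) / (n + 1 : ℝ))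
  have h2 : Measurable fun p : ℝ × Ω => (⌊p.1 * (n + 1 : ℝ)⌋₊, p.2) :=
    (Nat.measurable_floor.comp (measurable_fst.mul_const _)).prodMk measurable_snd
  have h3 : (fun p : ℝ × Ω => G ((⌊p.1 * (n + 1 : ℝ)⌋₊ : ℝ) / (n + 1 : ℝ)) p.2) =
      (fun q : ℕ × Ω => G ((q.1 : ℝ) / (n + 1 : ℝ)) q.2) ∘
        (fun p : ℝ × Ω => (⌊p.1 * (n + 1 : ℝ)⌋₊, p.2)) := by
    funext p
    rfl
  rw [h3]
  exact Measurable.comp h1 h2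

/-- Joint measurability of left-continuous processes on `II L`. -/
theorem joint_meas {Ω : Type*} [MeasurableSpace Ω] {L : ℝ≥0∞} {g : ℝ → Ω → ℝ}
    (hg : ∀ t ∈ II L, Measurable (g t)) (hlc : ∀ ω, LeftCts L fun t => g t ω) :
    Measurable fun p : ℝ × Ω => (II L).indicator (fun t => g t p.2) p.1 := by
  classical
  have hG : ∀ t, Measurable fun ω => (II L).indicator (fun t => g t ω) t := by
    intro t
    by_cases ht : t ∈ II L
    · simpa [ht] using hg t ht
    · simp [ht]
  refine measurable_of_tendsto_metrizable (f := fun (n : ℕ) (p : ℝ × Ω) =>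
    (Prod.fst ⁻¹' (II L)).indicator (fun p : ℝ × Ω => (II L).indicator (fun t => g t p.2)
      ((⌊p.1 * (n + 1 : ℝ)⌋₊ : ℝ) / (n + 1 : ℝ))) p) ?_ ?_
  · intro n
    refine Measurable.indicator ?_ (measurable_fst (II_measurable L))
    exact floor_meas (G := fun t ω => (II L).indicator (fun t => g t ω) t) hG n
  · rw [tendsto_pi_nhds]
    rintro ⟨t, ω⟩
    by_cases ht : t ∈ II L
    · have hle : ∀ n : ℕ, (⌊t * (n + 1 : ℝ)⌋₊ : ℝ) / (n + 1 : ℝ) ≤ t := by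
        intro n
        have hN : (0 : ℝ) < n + 1 := by positivity
        rw [div_le_iff₀ hN]
        exact Nat.floor_le (mul_nonneg ht.1 hN.le)
      have h0 : ∀ n : ℕ, 0 ≤ (⌊t * (n + 1 : ℝ)⌋₊ : ℝ) / (n + 1 : ℝ) := fun n => by positivity
      have hm : ∀ n : ℕ, (⌊t * (n + 1 : ℝ)⌋₊ : ℝ) / (n + 1 : ℝ) ∈ II L :=
        fun n => II_mem_of_le ht (h0 n) (hle n)
      have := tendsto_left (hlc ω) ht (floor_tendsto t ht.1) hle h0
      simpa [ht, hm] using this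
    · simp [ht]

theorem diff_iff {L : ℝ≥0∞} {g : ℝ → ℝ} (hg : LeftCts L g) {t : ℝ} :
    DifferentiableWithinAt ℝ g (II L) t ↔
      ∀ k : ℕ, ∃ m : ℕ, ∀ x y : ℚ, ((x : ℝ) ∈ II L ∧ (x : ℝ) ≠ t ∧ |(x : ℝ) - t| < 1 / (m + 1 : ℝ)) →
        ((y : ℝ) ∈ II L ∧ (y : ℝ) ≠ t ∧ |(y : ℝ) - t| < 1 / (m + 1 : ℝ)) →
        |(g x - g t) / (x - t) - (g y - g t) / (y - t)| ≤ 1 / (k + 1 : ℝ) := by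
  have hsl : ∀ x, slope g t x = (g x - g t) / (x - t) := fun x => slope_def_field g t x
  simp only [← hsl]
  constructor
  · intro h k
    have hd := (hasDerivWithinAt_iff_tendsto_slope.mp h.hasDerivWithinAt)
    have hk : (0 : ℝ) < 1 / (k + 1 : ℝ) / 2 := by positivity
    have h1 := Metric.tendsto_nhds.mp hd _ hk
    rw [eventually_nhdsWithin_iff, Metric.eventually_nhds_iff] at h1
    obtain ⟨δ, hδ, h1⟩ := h1
    obtain ⟨m, hm⟩ := exists_nat_one_div_lt hδ
    refine ⟨m, fun x y hx hy => ?_⟩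
    have hx' := h1 (y := x) (by rw [Real.dist_eq]; exact hx.2.2.trans hm) ⟨hx.1, hx.2.1⟩
    have hy' := h1 (y := y) (by rw [Real.dist_eq]; exact hy.2.2.trans hm) ⟨hy.1, hy.2.1⟩
    have := dist_triangle_right (slope g t x) (slope g t y) (derivWithin g (II L) t)
    rw [← Real.dist_eq]
    linarith
  · intro h
    by_cases hne : (𝓝[II L \ {t}] t).NeBot
    swap
    · rw [not_neBot] at hne
      have : HasDerivWithinAt g 0 (II L) t := by
        rw [hasDerivWithinAt_iff_tendsto_slope, hne]
        exact tendsto_bot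
      exact this.differentiableWithinAt
    have seq : ∀ (δ : ℝ) (s : ℝ), s ∈ II L → s ≠ t → |s - t| < δ → ∃ x : ℕ → ℚ,
        (∀ᶠ n in atTop, ((x n : ℝ) ∈ II L ∧ (x n : ℝ) ≠ t ∧ |(x n : ℝ) - t| < δ)) ∧
        Tendsto (fun n => slope g t (x n)) atTop (𝓝 (slope g t s)) := by
      intro δ s hs hst hd
      rcases hs.1.eq_or_lt with rfl | h0
      · refine ⟨fun _ => 0, Eventually.of_forall fun n => ?_, ?_⟩
        · simpa using ⟨hs, hst, by simpa using hd⟩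
        · simp
      · obtain ⟨x, -, hx, hxs⟩ := Real.exists_seq_rat_strictMono_tendsto s
        refine ⟨x, ?_, ?_⟩
        · have e1 := hxs.eventually (lt_mem_nhds h0)
          have e2 := hxs.eventually (isOpen_ne.mem_nhds hst)
          have e3 : ∀ᶠ n in atTop, |(x n : ℝ) - t| < δ :=
            ((hxs.sub_const t).abs).eventually (gt_mem_nhds hd)
          filter_upwards [e1, e2, e3] with n h1 h2 h3
          exact ⟨II_mem_of_le hs (le_of_lt h1) (hx n).le, h2, h3⟩
        · have h1 : Tendsto (fun n => g (x n)) atTop (𝓝 (g s)) :=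
            (hg s hs h0).comp (tendsto_nhdsWithin_iff.mpr ⟨hxs, Eventually.of_forall hx⟩)
          simp only [hsl]
          exact (h1.sub_const _).div (hxs.sub_const t) (sub_ne_zero.mpr hst)
    have hc : Cauchy (map (slope g t) (𝓝[II L \ {t}] t)) := by
      rw [Metric.cauchy_iff]
      refine ⟨hne.map _, fun ε hε => ?_⟩
      obtain ⟨k, hk⟩ := exists_nat_one_div_lt hε
      obtain ⟨m, hm⟩ := h k
      have hmpos : (0 : ℝ) < 1 / (m + 1 : ℝ) := by positivity
      refine ⟨slope g t '' {s | s ∈ II L ∧ s ≠ t ∧ |s - t| < 1 / (m + 1 : ℝ)},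
        image_mem_map ?_, ?_⟩
      · have : ∀ᶠ s in 𝓝[II L \ {t}] t, s ∈ II L \ {t} := eventually_mem_nhdsWithin
        have h2 : ∀ᶠ s in 𝓝[II L \ {t}] t, s ∈ Metric.ball t (1 / (m + 1 : ℝ)) :=
          nhdsWithin_le_nhds (Metric.ball_mem_nhds t hmpos)
        filter_upwards [this, h2] with s h1 h2
        exact ⟨h1.1, h1.2, by simpa [Real.dist_eq] using h2⟩
      · rintro _ ⟨s, ⟨hs1, hs2, hs3⟩, rfl⟩ _ ⟨r, ⟨hr1, hr2, hr3⟩, rfl⟩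
        obtain ⟨x, hx, hxl⟩ := seq _ s hs1 hs2 hs3
        obtain ⟨y, hy, hyl⟩ := seq _ r hr1 hr2 hr3
        rw [Real.dist_eq]
        refine lt_of_le_of_lt (le_of_tendsto (hxl.sub hyl).abs ?_) hk
        filter_upwards [hx, hy] with n h1 h2
        exact hm _ _ h1 h2
    obtain ⟨c, hc⟩ := CompleteSpace.complete hc
    exact (hasDerivWithinAt_iff_tendsto_slope.mpr hc).differentiableWithinAt

theorem diff_meas {Ω : Type*} [MeasurableSpace Ω] {L : ℝ≥0∞} {g : ℝ → Ω → ℝ}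
    (hg : ∀ t ∈ II L, Measurable (g t)) (hlc : ∀ ω, LeftCts L fun t => g t ω) :
    MeasurableSet {p : ℝ × Ω | p.1 ∈ II L ∧
      DifferentiableWithinAt ℝ (fun s => g s p.2) (II L) p.1} := by
  have hI : MeasurableSet {p : ℝ × Ω | p.1 ∈ II L} := measurable_fst (II_measurable L)
  have hJ := joint_meas hg hlc
  have : {p : ℝ × Ω | p.1 ∈ II L ∧ DifferentiableWithinAt ℝ (fun s => g s p.2) (II L) p.1} =
      {p : ℝ × Ω | p.1 ∈ II L} ∩ {p : ℝ × Ω | ∀ k : ℕ, ∃ m : ℕ, ∀ x y : ℚ,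
        ((x : ℝ) ∈ II L ∧ (x : ℝ) ≠ p.1 ∧ |(x : ℝ) - p.1| < 1 / (m + 1 : ℝ)) →
        ((y : ℝ) ∈ II L ∧ (y : ℝ) ≠ p.1 ∧ |(y : ℝ) - p.1| < 1 / (m + 1 : ℝ)) →
        |(g x p.2 - (II L).indicator (fun t => g t p.2) p.1) / (x - p.1) -
          (g y p.2 - (II L).indicator (fun t => g t p.2) p.1) / (y - p.1)| ≤ 1 / (k + 1 : ℝ)} := by
    ext ⟨t, ω⟩
    simp only [mem_setOf_eq, mem_inter_iff]
    refine and_congr_right fun ht => ?_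
    rw [diff_iff (hlc ω)]
    simp only [indicator_of_mem ht]
  rw [this]
  refine hI.inter ?_
  simp only [setOf_forall, setOf_exists]
  refine MeasurableSet.iInter fun k => MeasurableSet.iUnion fun m =>
    MeasurableSet.iInter fun x => MeasurableSet.iInter fun y => ?_
  by_cases hx : (x : ℝ) ∈ II L
  swap
  · simp [hx]
  by_cases hy : (y : ℝ) ∈ II L
  swap
  · simp [hy]
  have hgx : Measurable fun p : ℝ × Ω => g x p.2 := (hg x hx).comp measurable_snd
  have hgy : Measurable fun p : ℝ × Ω => g y p.2 := (hg y hy).comp measurable_snd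
  have hP : ∀ z : ℝ, MeasurableSet {p : ℝ × Ω | z ∈ II L ∧ z ≠ p.1 ∧ |z - p.1| < 1 / (m + 1 : ℝ)} := by
    intro z
    refine (MeasurableSet.const _).inter (MeasurableSet.inter ?_ ?_)
    · exact (measurableSet_eq_fun measurable_const measurable_fst).compl
    · exact measurableSet_lt (measurable_fst.const_sub z).abs measurable_const
  have hQ : MeasurableSet {p : ℝ × Ω |
      |(g x p.2 - (II L).indicator (fun t => g t p.2) p.1) / (x - p.1) -
          (g y p.2 - (II L).indicator (fun t => g t p.2) p.1) / (y - p.1)| ≤ 1 / (k + 1 : ℝ)} := by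
    refine measurableSet_le (Measurable.abs ?_) measurable_const
    exact ((hgx.sub hJ).div (measurable_fst.const_sub _)).sub
      ((hgy.sub hJ).div (measurable_fst.const_sub _))
  convert (hP x).compl.union ((hP y).compl.union hQ) using 1
  ext p
  simp only [mem_iInter, mem_setOf_eq, mem_union, mem_compl_iff]
  tauto

theorem borel_le_lebSA : (inferInstance : MeasurableSpace ℝ) ≤ lebSA := fun _ hs =>
  MeasurableSet.nullMeasurableSet hs

/-- For a weak stochastic process `a` whose paths are all left-continuous and
of bounded variation on `[0,L]`, the set
`S = {(t,ω) ∈ [0,L] × Ω : a₊(·,ω) and a₋(·,ω) are differentiable at t}` (one-sidedly at the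
endpoints, i.e. differentiability within `[0,L]`) belongs to `𝓛([0,L]) ⊗ ℱ`. -/
theorem stmt5 {Ω : Type*} [mΩ : MeasurableSpace Ω] (P : Measure Ω) [IsProbabilityMeasure P]
    (L : ℝ≥0∞) (hL : 0 < L) (a : ℝ → Ω → ℝ)
    (hmeas : ∀ t ∈ II L, Measurable fun ω => a t ω)
    (hlc : ∀ ω : Ω, LeftCts L fun t => a t ω)
    (hbv : ∀ ω : Ω, IsBV L fun t => a t ω) :
    MeasurableSet[lebSA.prod mΩ]
      {p : ℝ × Ω | p.1 ∈ II L ∧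
        DifferentiableWithinAt ℝ (fun s => posVar (fun u => a u p.2) s) (II L) p.1 ∧
        DifferentiableWithinAt ℝ (fun s => negVar (fun u => a u p.2) s) (II L) p.1} := by
  have hp := fun ω => fun t ht => bdd_pos (hbv ω) (t := t) ht
  have hn := fun ω => fun t ht => bdd_neg (hbv ω) (t := t) ht
  have h1 := diff_meas (L := L) (g := fun t ω => VV (fun x => max x 0) (fun u => a u ω) t)
    (fun t ht => VV_meas goodF_pos hmeas hlc hp ht)
    (fun ω => VV_leftcts goodF_pos (hlc ω) (hp ω))
  have h2 := diff_meas (L := L) (g := fun t ω => VV (fun x => max (-x) 0) (fun u => a u ω) t)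
    (fun t ht => VV_meas goodF_neg hmeas hlc hn ht)
    (fun ω => VV_leftcts goodF_neg (hlc ω) (hn ω))
  have hle : (inferInstance : MeasurableSpace (ℝ × Ω)) ≤ lebSA.prod mΩ :=
    sup_le_sup (MeasurableSpace.comap_mono borel_le_lebSA) le_rfl
  refine hle _ ?_
  convert h1.inter h2 using 1
  ext p
  simp only [mem_setOf_eq, mem_inter_iff, VV, posVar, negVar]
  tauto
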